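/- arXiv:1710.09936 — 3 statements merged into one kernel-verified Lean document; each statement's English description precedes it below -/
import Mathlib

section
/- Let I ⊆ ℝ be an interval and let f : I → (0,∞) satisfy f(t·x + (1−t)·y) ≤ f(x)^t · f(y)^{1−t} for all x,y ∈ I and t ∈ [0,1]. Then for all x, y, z ∈ I: f((x+z)/2)² · f((y+z)/2)² · f((x+y)/2)² ≤ f((x+y+z)/3)³ · f(x) · f(y) · f(z). -/
/-- Popoviciu's inequality when `x` and `y` lie on the same side of the mean `m` of `x, y, z`. -/
lemma ConvexOn.popoviciu_of_same_side {I : Set ℝ} {g : ℝ → ℝ} (hg : ConvexOn ℝ I g)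
    {x y z m : ℝ} (hx : x ∈ I) (hy : y ∈ I) (hz : z ∈ I) (hm : m ∈ I) (hmean : x + y + z = 3 * m)
    (hside : (x ≤ m ∧ y ≤ m) ∨ (m ≤ x ∧ m ≤ y)) :
    2 * (g ((x + z) / 2) + g ((y + z) / 2) + g ((x + y) / 2)) ≤ 3 * g m + g x + g y + g z := by
  obtain ⟨a, b, ha, hb, hab, hay, hbx⟩ : ∃ a b : ℝ, 0 ≤ a ∧ 0 ≤ b ∧ a + b = 1 ∧
      m - y = a * (z - m) ∧ m - x = b * (z - m) := by
    by_cases hzm : z - m = 0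
    · refine ⟨1, 0, by norm_num, by norm_num, by norm_num, ?_, ?_⟩ <;>
        rcases hside with h | h <;> linarith [h.1, h.2]
    · refine ⟨(m - y) / (z - m), (m - x) / (z - m), ?_, ?_, ?_, ?_, ?_⟩
      · rcases hside with ⟨h₁, h₂⟩ | ⟨h₁, h₂⟩
        · exact div_nonneg (by linarith) (by linarith)
        · exact div_nonneg_of_nonpos (by linarith) (by linarith)
      · rcases hside with ⟨h₁, h₂⟩ | ⟨h₁, h₂⟩
        · exact div_nonneg (by linarith) (by linarith)
        · exact div_nonneg_of_nonpos (by linarith) (by linarith)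
      · rw [← add_div, div_eq_one_iff_eq hzm]
        linarith
      · rw [div_mul_cancel₀ _ hzm]
      · rw [div_mul_cancel₀ _ hzm]
  obtain ⟨-, hconv⟩ := hg
  have hxz := hconv hm hz (a := 1 - a / 2) (b := a / 2) (by linarith) (by linarith) (by ring)
  have hyz := hconv hm hz (a := 1 - b / 2) (b := b / 2) (by linarith) (by linarith) (by ring)
  have hxy := hconv hx hy (a := 1 / 2) (b := 1 / 2) (by norm_num) (by norm_num) (by norm_num)
  simp only [smul_eq_mul] at hxz hyz hxy
  rw [show (1 - a / 2) * m + a / 2 * z = (x + z) / 2 by linarith] at hxz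
  rw [show (1 - b / 2) * m + b / 2 * z = (y + z) / 2 by linarith] at hyz
  rw [show 1 / 2 * x + 1 / 2 * y = (x + y) / 2 by ring] at hxy
  obtain rfl : b = 1 - a := by linarith
  linarith

/-- **Popoviciu's inequality** for convex functions. -/
lemma ConvexOn.popoviciu {I : Set ℝ} {g : ℝ → ℝ} (hg : ConvexOn ℝ I g)
    {x y z : ℝ} (hx : x ∈ I) (hy : y ∈ I) (hz : z ∈ I) (hm : (x + y + z) / 3 ∈ I) :
    2 * (g ((x + z) / 2) + g ((y + z) / 2) + g ((x + y) / 2)) ≤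
      3 * g ((x + y + z) / 3) + g x + g y + g z := by
  generalize hmean : (x + y + z) / 3 = m at hm ⊢
  have hxy := hg.popoviciu_of_same_side hx hy hz hm (by linarith)
  have hxz := hg.popoviciu_of_same_side hx hz hy hm (by linarith)
  have hyz := hg.popoviciu_of_same_side hy hz hx hm (by linarith)
  rw [add_comm z y] at hxz
  rw [add_comm y x, add_comm z x] at hyz
  rcases le_total x m with h₁ | h₁ <;> rcases le_total y m with h₂ | h₂ <;>
    rcases le_total z m with h₃ | h₃ <;>
    first
    | linarith [hxy (by tauto)]
    | linarith [hxz (by tauto)]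
    | linarith [hyz (by tauto)]

/-- Popoviciu-type inequality for `A_tG_t`-convex (log-convex) functions. -/
theorem popoviciu_AG (I : Set ℝ) (hI : Convex ℝ I)
    (f : ℝ → ℝ) (hf_pos : ∀ x ∈ I, 0 < f x)
    (hf : ∀ x ∈ I, ∀ y ∈ I, ∀ t ∈ Set.Icc (0 : ℝ) 1,
      f (t * x + (1 - t) * y) ≤ f x ^ t * f y ^ (1 - t)) :
    ∀ x ∈ I, ∀ y ∈ I, ∀ z ∈ I,
      f ((x + z) / 2) ^ 2 * f ((y + z) / 2) ^ 2 * f ((x + y) / 2) ^ 2 ≤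
        f ((x + y + z) / 3) ^ 3 * f x * f y * f z := by
  intro x hx y hy z hz
  have hlog : ConvexOn ℝ I (fun u => Real.log (f u)) := by
    refine ⟨hI, fun u hu v hv a b ha hb hab => ?_⟩
    have hmem := hI hu hv ha hb hab
    obtain rfl : b = 1 - a := by linarith
    simp only [smul_eq_mul] at hmem ⊢
    have h := Real.log_le_log (hf_pos _ hmem) (hf u hu v hv a ⟨ha, by linarith⟩)
    rwa [Real.log_mul (Real.rpow_pos_of_pos (hf_pos u hu) _).ne'
      (Real.rpow_pos_of_pos (hf_pos v hv) _).ne', Real.log_rpow (hf_pos u hu),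
      Real.log_rpow (hf_pos v hv)] at h
  have hmid : ∀ u ∈ I, ∀ v ∈ I, (u + v) / 2 ∈ I := fun u hu v hv => by
    convert hI hu hv (a := 1 / 2) (b := 1 / 2) (by norm_num) (by norm_num) (by norm_num) using 1
    simp only [smul_eq_mul]
    ring
  have hm : (x + y + z) / 3 ∈ I := by
    convert hI (hmid x hx y hy) hz (a := 2 / 3) (b := 1 / 3) (by norm_num) (by norm_num)
      (by norm_num) using 1
    simp only [smul_eq_mul]
    ring
  have hpop := hlog.popoviciu hx hy hz hm
  have pxz := hf_pos _ (hmid x hx z hz)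
  have pyz := hf_pos _ (hmid y hy z hz)
  have pxy := hf_pos _ (hmid x hx y hy)
  have pm := hf_pos _ hm
  have px := hf_pos x hx
  have py := hf_pos y hy
  have pz := hf_pos z hz
  rw [← Real.log_le_log_iff (by positivity) (by positivity),
    Real.log_mul (by positivity) (by positivity), Real.log_mul (by positivity) (by positivity),
    Real.log_mul (by positivity) (by positivity), Real.log_mul (by positivity) (by positivity),
    Real.log_mul (by positivity) (by positivity)]
  simp only [Real.log_pow]
  push_cast
  linarith
end

section
/- Let I ⊆ (0,∞) be an interval and let f : I → (0,∞) satisfy f(x^t · y^{1−t}) ≤ f(x)^t · f(y)^{1−t} for all x,y ∈ I and t ∈ [0,1]. Then for all x, y, z ∈ I: f(√(xz))² · f(√(yz))² · f(√(xy))² ≤ f((xyz)^{1/3})³ · f(x) · f(y) · f(z). -/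
theorem Convex.add_div_two_mem {s : Set ℝ} (hs : Convex ℝ s) {a b : ℝ} (ha : a ∈ s) (hb : b ∈ s) :
    (a + b) / 2 ∈ s := by
  have h : (1 / 2 : ℝ) • a + (1 / 2 : ℝ) • b ∈ s :=
    hs ha hb (by norm_num) (by norm_num) (by norm_num)
  convert h using 1
  simp only [smul_eq_mul]
  ring

theorem Convex.add_add_div_three_mem {s : Set ℝ} (hs : Convex ℝ s) {a b c : ℝ}
    (ha : a ∈ s) (hb : b ∈ s) (hc : c ∈ s) : (a + b + c) / 3 ∈ s := by
  have h : (2 / 3 : ℝ) • ((a + b) / 2) + (1 / 3 : ℝ) • c ∈ s :=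
    hs (hs.add_div_two_mem ha hb) hc (by norm_num) (by norm_num) (by norm_num)
  convert h using 1
  simp only [smul_eq_mul]
  ring

theorem ConvexOn.add_le_of_mem_segment_of_add_eq {s : Set ℝ} {g : ℝ → ℝ} (hg : ConvexOn ℝ s g)
    {m c p q : ℝ} (hm : m ∈ s) (hc : c ∈ s) (hp : p ∈ segment ℝ m c) (hq : q ∈ segment ℝ m c)
    (hpq : p + q = (3 * m + c) / 2) :
    g p + g q ≤ (3 * g m + g c) / 2 := by
  obtain ⟨u, v, hu, hv, huv, rfl⟩ := hp
  obtain ⟨u', v', hu', hv', huv', rfl⟩ := hq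
  have h := hg.2 hm hc hu hv huv
  have h' := hg.2 hm hc hu' hv' huv'
  rcases eq_or_ne m c with rfl | hne
  · rw [← add_smul, huv, one_smul] at h ⊢
    rw [← add_smul, huv', one_smul]
    linarith
  · simp only [smul_eq_mul] at *
    obtain rfl : u = 1 - v := by linarith
    obtain rfl : u' = 1 - v' := by linarith
    have hvv : v + v' = 1 / 2 :=
      mul_right_cancel₀ (sub_ne_zero.2 hne) (by linear_combination -hpq)
    obtain rfl : v' = 1 / 2 - v := by linarith
    linarith

theorem ConvexOn.popoviciu_of_same_side_s10 {s : Set ℝ} {g : ℝ → ℝ} (hg : ConvexOn ℝ s g)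
    {a b c m : ℝ} (ha : a ∈ s) (hb : b ∈ s) (hc : c ∈ s) (hm : m ∈ s) (habc : a + b + c = 3 * m)
    (hside : (a ≤ m ∧ b ≤ m) ∨ (m ≤ a ∧ m ≤ b)) :
    2 * (g ((a + c) / 2) + g ((b + c) / 2) + g ((a + b) / 2)) ≤ 3 * g m + g a + g b + g c := by
  have hmid : g ((a + b) / 2) ≤ (g a + g b) / 2 := by
    have h : g ((1 / 2 : ℝ) • a + (1 / 2 : ℝ) • b) ≤ (1 / 2 : ℝ) • g a + (1 / 2 : ℝ) • g b :=
      hg.2 ha hb (by norm_num) (by norm_num) (by norm_num)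
    simp only [smul_eq_mul] at h
    rw [show (a + b) / 2 = 1 / 2 * a + 1 / 2 * b by ring]
    linarith
  have hmem : (a + c) / 2 ∈ segment ℝ m c ∧ (b + c) / 2 ∈ segment ℝ m c := by
    rcases hside with ⟨_, _⟩ | ⟨_, _⟩
    · rw [segment_eq_Icc (by linarith)]
      constructor <;> constructor <;> linarith
    · rw [segment_symm, segment_eq_Icc (by linarith)]
      constructor <;> constructor <;> linarith
  have h := hg.add_le_of_mem_segment_of_add_eq hm hc hmem.1 hmem.2 (by linarith)
  linarith

/-- **Popoviciu's inequality** for convex functions. -/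
theorem ConvexOn.popoviciu_s10 {s : Set ℝ} {g : ℝ → ℝ} (hg : ConvexOn ℝ s g)
    {a b c : ℝ} (ha : a ∈ s) (hb : b ∈ s) (hc : c ∈ s) :
    2 * (g ((a + c) / 2) + g ((b + c) / 2) + g ((a + b) / 2)) ≤
      3 * g ((a + b + c) / 3) + g a + g b + g c := by
  obtain ⟨m, hm⟩ : ∃ m, m = (a + b + c) / 3 := ⟨_, rfl⟩
  have hms : m ∈ s := hm ▸ hg.1.add_add_div_three_mem ha hb hc
  rw [← hm]
  have hab := hg.popoviciu_of_same_side_s10 ha hb hc hms (by linarith)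
  have hac := hg.popoviciu_of_same_side_s10 ha hc hb hms (by linarith)
  have hbc := hg.popoviciu_of_same_side_s10 hb hc ha hms (by linarith)
  rw [add_comm c b] at hac
  rw [add_comm b a, add_comm c a] at hbc
  rcases le_total a m with h₁ | h₁ <;> rcases le_total b m with h₂ | h₂ <;>
    rcases le_total c m with h₃ | h₃ <;>
    first
    | exact hab (by tauto)
    | linarith [hac (by tauto)]
    | linarith [hbc (by tauto)]

theorem convexOn_log_comp_exp {I : Set ℝ} (hI : Convex ℝ I) {f : ℝ → ℝ}
    (hf_pos : ∀ x ∈ I, 0 < f x)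
    (hf : ∀ x ∈ I, ∀ y ∈ I, ∀ t ∈ Set.Icc (0 : ℝ) 1,
      f (x ^ t * y ^ (1 - t)) ≤ f x ^ t * f y ^ (1 - t)) :
    ConvexOn ℝ (Real.exp ⁻¹' I) fun u => Real.log (f (Real.exp u)) := by
  have hconv : Convex ℝ (Real.exp ⁻¹' I) :=
    (hI.ordConnected.preimage_mono Real.exp_monotone).convex
  refine ⟨hconv, fun u hu v hv a b ha hb hab => ?_⟩
  have hmem : Real.exp (a • u + b • v) ∈ I := hconv hu hv ha hb hab
  obtain rfl : b = 1 - a := by linarith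
  have hfu := hf_pos _ hu
  have hfv := hf_pos _ hv
  have h := hf _ hu _ hv a ⟨ha, by linarith⟩
  rw [← Real.exp_mul, ← Real.exp_mul, ← Real.exp_add, mul_comm u, mul_comm v] at h
  have hlog := Real.log_le_log (hf_pos _ hmem) h
  rwa [Real.log_mul (by positivity) (by positivity), Real.log_rpow hfu, Real.log_rpow hfv] at hlog

/-- Popoviciu-type inequality for `G_tG_t`-convex functions. -/
theorem popoviciu_GG (I : Set ℝ) (hI : Convex ℝ I) (hI_pos : I ⊆ Set.Ioi (0 : ℝ))
    (f : ℝ → ℝ) (hf_pos : ∀ x ∈ I, 0 < f x)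
    (hf : ∀ x ∈ I, ∀ y ∈ I, ∀ t ∈ Set.Icc (0 : ℝ) 1,
      f (x ^ t * y ^ (1 - t)) ≤ f x ^ t * f y ^ (1 - t)) :
    ∀ x ∈ I, ∀ y ∈ I, ∀ z ∈ I,
      f (Real.sqrt (x * z)) ^ 2 * f (Real.sqrt (y * z)) ^ 2 * f (Real.sqrt (x * y)) ^ 2 ≤
        f ((x * y * z) ^ ((1 : ℝ) / 3)) ^ 3 * f x * f y * f z := by
  intro x hx y hy z hz
  obtain ⟨a, rfl⟩ : ∃ a, Real.exp a = x := ⟨_, Real.exp_log (hI_pos hx)⟩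
  obtain ⟨b, rfl⟩ : ∃ b, Real.exp b = y := ⟨_, Real.exp_log (hI_pos hy)⟩
  obtain ⟨c, rfl⟩ : ∃ c, Real.exp c = z := ⟨_, Real.exp_log (hI_pos hz)⟩
  have hg := convexOn_log_comp_exp hI hf_pos hf
  have hm : 0 < f (Real.exp ((a + b + c) / 3)) := hf_pos _ (hg.1.add_add_div_three_mem hx hy hz)
  have hac : 0 < f (Real.exp ((a + c) / 2)) := hf_pos _ (hg.1.add_div_two_mem hx hz)
  have hbc : 0 < f (Real.exp ((b + c) / 2)) := hf_pos _ (hg.1.add_div_two_mem hy hz)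
  have hab : 0 < f (Real.exp ((a + b) / 2)) := hf_pos _ (hg.1.add_div_two_mem hx hy)
  have ha := hf_pos _ hx
  have hb := hf_pos _ hy
  have hc := hf_pos _ hz
  simp only [← Real.exp_add, ← Real.exp_half, ← Real.exp_mul, mul_one_div]
  have h := hg.popoviciu_s10 hx hy hz
  rw [← Real.log_le_log_iff (by positivity) (by positivity)]
  simp only [Real.log_mul, Real.log_pow, ne_eq, mul_eq_zero, pow_eq_zero_iff, hac.ne', hbc.ne',
    hab.ne', hm.ne', ha.ne', hb.ne', hc.ne', or_self, not_false_eq_true, OfNat.ofNat_ne_zero]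
  push_cast
  linarith
end

section
/- Let I ⊆ (0,∞) be an interval, let h : [0,∞) → [0,∞) be superadditive (h(s+t) ≥ h(s) + h(t) for all s,t ≥ 0), and let f : I → (0,∞) satisfy f(x·y / (t·x + (1−t)·y)) ≤ h(1−t)·f(x) + h(t)·f(y) for all x,y ∈ I and t ∈ [0,1]. Then for all x, y, z ∈ I: f(2xz/(x+z)) + f(2yz/(y+z)) + f(2xy/(x+y)) ≤ h(3/2)·f(3xyz/(xy + yz + xz)) + h(1/2)·(f(x) + f(y) + f(z)). -/
/-- If the deviations of `a` and `b` from the mean of `a, b, c` have the same sign, the midpoints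
of `a, c` and of `b, c` divide the segment from that mean to `c` with weights summing to `1 / 2`. -/
lemma exists_midpoint_weights {a b c : ℝ}
    (hs : (0 ≤ a + c - 2 * b ∧ 0 ≤ b + c - 2 * a) ∨ (a + c - 2 * b ≤ 0 ∧ b + c - 2 * a ≤ 0)) :
    ∃ s t : ℝ, 0 ≤ s ∧ 0 ≤ t ∧ s + t = 1 / 2 ∧
      (a + c) / 2 = (1 - s) * ((a + b + c) / 3) + s * c ∧
      (b + c) / 2 = (1 - t) * ((a + b + c) / 3) + t * c := by
  by_cases hd : 2 * c - a - b = 0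
  · refine ⟨1 / 4, 1 / 4, by norm_num, by norm_num, by norm_num, ?_, ?_⟩ <;>
      rcases hs with ⟨_, _⟩ | ⟨_, _⟩ <;> linarith
  · refine ⟨(a + c - 2 * b) / (2 * (2 * c - a - b)), (b + c - 2 * a) / (2 * (2 * c - a - b)),
      ?_, ?_, ?_, ?_, ?_⟩
    · rcases hs with ⟨_, _⟩ | ⟨_, _⟩
      · exact div_nonneg (by linarith) (by linarith)
      · exact div_nonneg_of_nonpos (by linarith) (by linarith)
    · rcases hs with ⟨_, _⟩ | ⟨_, _⟩
      · exact div_nonneg (by linarith) (by linarith)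
      · exact div_nonneg_of_nonpos (by linarith) (by linarith)
    all_goals
      obtain ⟨d, hb⟩ : ∃ d, b = 2 * c - a - d := ⟨2 * c - a - b, by ring⟩
      subst hb
      rw [sub_sub_cancel] at hd ⊢
      field_simp
      ring

/-- Popoviciu's inequality for an `h`-convex function, for points in a prescribed relative
position. -/
lemma popoviciu_hconvex_of_same_side {J : Set ℝ} {h g : ℝ → ℝ}
    (hh_super : ∀ s, 0 ≤ s → ∀ t, 0 ≤ t → h s + h t ≤ h (s + t))
    (hg_nonneg : ∀ u ∈ J, 0 ≤ g u)
    (hg : ∀ u ∈ J, ∀ v ∈ J, ∀ t ∈ Set.Icc (0 : ℝ) 1,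
      g ((1 - t) * u + t * v) ≤ h (1 - t) * g u + h t * g v)
    {a b c : ℝ} (ha : a ∈ J) (hb : b ∈ J) (hc : c ∈ J) (hm : (a + b + c) / 3 ∈ J)
    (hs : (0 ≤ a + c - 2 * b ∧ 0 ≤ b + c - 2 * a) ∨ (a + c - 2 * b ≤ 0 ∧ b + c - 2 * a ≤ 0)) :
    g ((a + c) / 2) + g ((b + c) / 2) + g ((a + b) / 2) ≤
      h (3 / 2) * g ((a + b + c) / 3) + h (1 / 2) * (g a + g b + g c) := by
  obtain ⟨s, t, hs0, ht0, hst, hac, hbc⟩ := exists_midpoint_weights hs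
  have h₁ := hg _ hm c hc s ⟨hs0, by linarith⟩
  have h₂ := hg _ hm c hc t ⟨ht0, by linarith⟩
  have h₃ := hg a ha b hb (1 / 2) ⟨by norm_num, by norm_num⟩
  rw [← hac] at h₁
  rw [← hbc] at h₂
  rw [show (1 - 1 / 2 : ℝ) = 1 / 2 by norm_num,
    show 1 / 2 * a + 1 / 2 * b = (a + b) / 2 by ring] at h₃
  have h₄ := hh_super s hs0 t ht0
  have h₅ := hh_super (1 - s) (by linarith) (1 - t) (by linarith)
  rw [hst] at h₄
  rw [show 1 - s + (1 - t) = 3 / 2 by linarith] at h₅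
  have h₆ := mul_le_mul_of_nonneg_right h₄ (hg_nonneg c hc)
  have h₇ := mul_le_mul_of_nonneg_right h₅ (hg_nonneg _ hm)
  linarith

/-- Popoviciu's inequality for `h`-convex functions with superadditive `h`. -/
lemma popoviciu_hconvex {J : Set ℝ} (hJ : Convex ℝ J) {h g : ℝ → ℝ}
    (hh_super : ∀ s, 0 ≤ s → ∀ t, 0 ≤ t → h s + h t ≤ h (s + t))
    (hg_nonneg : ∀ u ∈ J, 0 ≤ g u)
    (hg : ∀ u ∈ J, ∀ v ∈ J, ∀ t ∈ Set.Icc (0 : ℝ) 1,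
      g ((1 - t) * u + t * v) ≤ h (1 - t) * g u + h t * g v)
    {a b c : ℝ} (ha : a ∈ J) (hb : b ∈ J) (hc : c ∈ J) :
    g ((a + c) / 2) + g ((b + c) / 2) + g ((a + b) / 2) ≤
      h (3 / 2) * g ((a + b + c) / 3) + h (1 / 2) * (g a + g b + g c) := by
  have hm : (a + b + c) / 3 ∈ J := by
    have hab : (1 / 2 : ℝ) • a + (1 / 2 : ℝ) • b ∈ J :=
      hJ ha hb (by norm_num) (by norm_num) (by norm_num)
    have habc := hJ hab hc (a := 2 / 3) (b := 1 / 3) (by norm_num) (by norm_num) (by norm_num)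
    convert habc using 1
    simp only [smul_eq_mul]
    ring
  have key {a b c : ℝ} := popoviciu_hconvex_of_same_side (a := a) (b := b) (c := c)
    hh_super hg_nonneg hg
  by_cases hab : (0 ≤ a + c - 2 * b ∧ 0 ≤ b + c - 2 * a) ∨
      (a + c - 2 * b ≤ 0 ∧ b + c - 2 * a ≤ 0)
  · exact key ha hb hc hm hab
  by_cases hbc : (0 ≤ b + a - 2 * c ∧ 0 ≤ c + a - 2 * b) ∨
      (b + a - 2 * c ≤ 0 ∧ c + a - 2 * b ≤ 0)
  · have := key hb hc ha (by rwa [show b + c + a = a + b + c by ring]) hbc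
    rw [show b + c + a = a + b + c by ring, add_comm b a, add_comm c a] at this
    linarith
  · have := key hc ha hb (by rwa [show c + a + b = a + b + c by ring]) (by grind)
    rw [show c + a + b = a + b + c by ring, add_comm c a, add_comm c b] at this
    linarith

/-- Popoviciu-type inequality for `H_tA_h`-convex functions with superadditive `h`. -/
theorem popoviciu_HA_h (I : Set ℝ) (hI : Convex ℝ I) (hI_pos : I ⊆ Set.Ioi (0 : ℝ))
    (h : ℝ → ℝ) (hh_nonneg : ∀ s, 0 ≤ s → 0 ≤ h s)
    (hh_super : ∀ s, 0 ≤ s → ∀ t, 0 ≤ t → h s + h t ≤ h (s + t))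
    (f : ℝ → ℝ) (hf_pos : ∀ x ∈ I, 0 < f x)
    (hf : ∀ x ∈ I, ∀ y ∈ I, ∀ t ∈ Set.Icc (0 : ℝ) 1,
      f (x * y / (t * x + (1 - t) * y)) ≤ h (1 - t) * f x + h t * f y) :
    ∀ x ∈ I, ∀ y ∈ I, ∀ z ∈ I,
      f (2 * x * z / (x + z)) + f (2 * y * z / (y + z)) + f (2 * x * y / (x + y)) ≤
        h (3 / 2) * f (3 * x * y * z / (x * y + y * z + x * z)) +
          h (1 / 2) * (f x + f y + f z) := by
  intro x hx y hy z hz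
  have hx0 : 0 < x := hI_pos hx
  have hy0 : 0 < y := hI_pos hy
  have hz0 : 0 < z := hI_pos hz
  have hJ : Convex ℝ {u : ℝ | 0 < u ∧ u⁻¹ ∈ I} := by
    refine Set.OrdConnected.convex ⟨?_⟩
    rintro u ⟨hu, huI⟩ v ⟨hv, hvI⟩ w ⟨huw, hwv⟩
    have hw : 0 < w := hu.trans_le huw
    exact ⟨hw, hI.ordConnected.out hvI huI
      ⟨inv_anti₀ hw hwv, inv_anti₀ hu huw⟩⟩
  have key := popoviciu_hconvex hJ (g := fun u ↦ f u⁻¹) hh_super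
    (fun u hu ↦ (hf_pos _ hu.2).le)
    (by
      rintro u ⟨hu, huI⟩ v ⟨hv, hvI⟩ t ht
      convert hf _ huI _ hvI t ht using 2
      field_simp
      rw [add_comm])
    (a := x⁻¹) (b := y⁻¹) (c := z⁻¹)
    ⟨inv_pos.2 hx0, by rwa [inv_inv]⟩ ⟨inv_pos.2 hy0, by rwa [inv_inv]⟩
    ⟨inv_pos.2 hz0, by rwa [inv_inv]⟩
  simp only [inv_inv] at key
  have harm {p q : ℝ} (hp : 0 < p) (hq : 0 < q) :
      ((p⁻¹ + q⁻¹) / 2)⁻¹ = 2 * p * q / (p + q) := by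
    field_simp
    ring
  have harm₃ : ((x⁻¹ + y⁻¹ + z⁻¹) / 3)⁻¹ = 3 * x * y * z / (x * y + y * z + x * z) := by
    field_simp
    ring
  rwa [harm hx0 hz0, harm hy0 hz0, harm hx0 hy0, harm₃] at key
end
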